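/- Let Γ be a countable group acting by homeomorphisms on a set X and acting on a countable set K. Suppose there exists a sequence of maps μₙ : X → Prob(K) such that for all γ ∈ Γ and all x ∈ X, ‖μₙ(γ·x) − γ·μₙ(x)‖₁ → 0 as n → ∞, and suppose that for every k ∈ K the stabilizer Stab_Γ(k) is amenable. Then there exists a sequence of maps λₙ : X → Prob(Γ) such that for all γ ∈ Γ and all x ∈ X, ‖λₙ(γ·x) − γ·λₙ(x)‖₁ → 0 as n → ∞ (i.e., the Γ-action on X is amenable in the pointwise/Borel sense, ignoring measurability of the maps). -/

import Mathlib

noncomputable section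
open Filter Topology

/-- A probability measure on a countable set, seen as a nonnegative ℓ¹-function summing to 1. -/
def IsProbFn {K : Type*} (μ : K → ℝ) : Prop := (∀ k, 0 ≤ μ k) ∧ HasSum μ 1

/-- ℓ¹-distance between two measures on a countable set. -/
def l1dist {K : Type*} (μ ν : K → ℝ) : ℝ := ∑' k, |μ k - ν k|

/-- Pushforward of a measure under the action of a group element. -/
def pushAct {Γ K : Type*} [Group Γ] [MulAction Γ K] (γ : Γ) (μ : K → ℝ) : K → ℝ :=
  fun k => μ (γ⁻¹ • k)

/-- Amenability of a countable group via a Reiter sequence. -/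
def ReiterAmenable (Γ : Type*) [Group Γ] : Prop :=
  ∃ ν : ℕ → Γ → ℝ, (∀ n, IsProbFn (ν n)) ∧
    ∀ γ : Γ, Tendsto (fun n => l1dist (pushAct γ (ν n)) (ν n)) atTop (𝓝 0)

/-- The mixture `∑ₖ a k • ν k` of a family of functions with weights `a`. -/
def mixture {K Γ : Type*} (a : K → ℝ) (ν : K → Γ → ℝ) : Γ → ℝ :=
  fun g => ∑' k, a k * ν k g

theorem IsProbFn.summable {K : Type*} {μ : K → ℝ} (h : IsProbFn μ) : Summable μ := h.2.summable

theorem IsProbFn.pushAct {Γ K : Type*} [Group Γ] [MulAction Γ K] {μ : K → ℝ} (h : IsProbFn μ)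
    (γ : Γ) : IsProbFn (pushAct γ μ) :=
  ⟨fun _ => h.1 _, (MulAction.toPerm γ⁻¹).hasSum_iff.2 h.2⟩

theorem IsProbFn.extend {α β : Type*} {f : α → β} (hf : Function.Injective f) {μ : α → ℝ}
    (h : IsProbFn μ) : IsProbFn (Function.extend f μ 0) := by
  refine ⟨fun b => ?_, (hasSum_extend_zero hf).2 h.2⟩
  by_cases hb : ∃ a, f a = b
  · obtain ⟨a, rfl⟩ := hb
    rw [hf.extend_apply]
    exact h.1 a
  · rw [Function.extend_apply' _ _ _ hb, Pi.zero_apply]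

theorem l1dist_comm {K : Type*} (μ ν : K → ℝ) : l1dist μ ν = l1dist ν μ :=
  tsum_congr fun _ => abs_sub_comm _ _

theorem l1dist_nonneg {K : Type*} (μ ν : K → ℝ) : 0 ≤ l1dist μ ν :=
  tsum_nonneg fun _ => abs_nonneg _

theorem IsProbFn.summable_abs_sub {K : Type*} {μ ν : K → ℝ} (hμ : IsProbFn μ)
    (hν : IsProbFn ν) : Summable fun k => |μ k - ν k| :=
  (hμ.summable.sub hν.summable).abs

theorem IsProbFn.l1dist_le_two {K : Type*} {μ ν : K → ℝ} (hμ : IsProbFn μ)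
    (hν : IsProbFn ν) : l1dist μ ν ≤ 2 := by
  have hs : HasSum (fun k => μ k + ν k) 2 := by
    simpa [one_add_one_eq_two] using hμ.2.add hν.2
  refine (hμ.summable_abs_sub hν).tsum_le_of_sum_le fun s => ?_
  refine (Finset.sum_le_sum fun k _ => ?_).trans
    (sum_le_hasSum s (fun k _ => add_nonneg (hμ.1 k) (hν.1 k)) hs)
  rw [abs_le]
  constructor <;> linarith [hμ.1 k, hν.1 k]

theorem pushAct_mul {Γ K : Type*} [Group Γ] [MulAction Γ K] (γ δ : Γ) (μ : K → ℝ) :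
    pushAct (γ * δ) μ = pushAct γ (pushAct δ μ) := by
  funext k
  simp [pushAct, mul_smul]

theorem l1dist_pushAct {Γ K : Type*} [Group Γ] [MulAction Γ K] (γ : Γ) (μ ν : K → ℝ) :
    l1dist (pushAct γ μ) (pushAct γ ν) = l1dist μ ν :=
  (MulAction.toPerm γ⁻¹).tsum_eq fun k => |μ k - ν k|

theorem l1dist_extend {α β : Type*} {f : α → β} (hf : Function.Injective f) (μ ν : α → ℝ) :
    l1dist (Function.extend f μ 0) (Function.extend f ν 0) = l1dist μ ν := by
  rw [l1dist, l1dist, ← tsum_extend_zero hf]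
  refine tsum_congr fun b => ?_
  by_cases hb : ∃ a, f a = b
  · obtain ⟨a, rfl⟩ := hb
    simp only [hf.extend_apply]
  · simp [Function.extend_apply' _ _ _ hb]

theorem pushAct_extend_subtype_val {Γ : Type*} [Group Γ] (H : Subgroup Γ) (h : H) (μ : H → ℝ) :
    pushAct (h : Γ) (Function.extend Subtype.val μ 0) =
      Function.extend Subtype.val (pushAct h μ) 0 := by
  funext g
  have hinj : Function.Injective (Subtype.val : H → Γ) := Subtype.val_injective
  by_cases hg : g ∈ H
  · have h1 := hinj.extend_apply μ 0 (h⁻¹ * ⟨g, hg⟩)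
    have h2 := hinj.extend_apply (pushAct h μ) 0 ⟨g, hg⟩
    exact h1.trans h2.symm
  · have hg' : (h : Γ)⁻¹ * g ∉ H := fun hm => hg <| (H.mul_mem_cancel_left (H.inv_mem h.2)).1 hm
    rw [pushAct, smul_eq_mul, Function.extend_apply' _ _ _ (by simpa using hg'),
      Function.extend_apply' _ _ _ (by simpa using hg)]
    rfl

/-- A Reiter sequence on a subgroup, viewed as a sequence on the ambient group. -/
theorem ReiterAmenable.exists_seq_of_subgroup {Γ : Type*} [Group Γ] {H : Subgroup Γ}
    (hH : ReiterAmenable H) : ∃ ρ : ℕ → Γ → ℝ, (∀ n, IsProbFn (ρ n)) ∧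
      ∀ h ∈ H, Tendsto (fun n => l1dist (pushAct h (ρ n)) (ρ n)) atTop (𝓝 0) := by
  obtain ⟨ν, hν, hlim⟩ := hH
  refine ⟨fun n => Function.extend Subtype.val (ν n) 0,
    fun n => (hν n).extend Subtype.val_injective, fun h hh => ?_⟩
  refine (hlim ⟨h, hh⟩).congr fun n => ?_
  rw [← l1dist_extend (Subtype.val_injective : Function.Injective (Subtype.val : H → Γ)),
    ← pushAct_extend_subtype_val]

/-- Amenable stabilizers yield almost-equivariant maps `K → Prob(Γ)`. -/
theorem exists_almost_equivariant_of_stabilizer {Γ K : Type*} [Group Γ] [MulAction Γ K]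
    (hstab : ∀ k : K, ReiterAmenable ↥(MulAction.stabilizer Γ k)) :
    ∃ ν : ℕ → K → Γ → ℝ, (∀ m k, IsProbFn (ν m k)) ∧ ∀ (γ : Γ) (k : K),
      Tendsto (fun m => l1dist (ν m k) (pushAct γ (ν m (γ⁻¹ • k)))) atTop (𝓝 0) := by
  choose ρ hρ hlim using fun k => (hstab k).exists_seq_of_subgroup
  let r : K → K := fun k => (Quotient.mk (MulAction.orbitRel Γ K) k).out
  have hr : ∀ k, ∃ γ : Γ, γ • r k = k := fun k =>
    (MulAction.orbitRel Γ K).symm (Quotient.mk_out (s := MulAction.orbitRel Γ K) k)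
  choose σ hσ using hr
  have hr_smul : ∀ (γ : Γ) k, r (γ • k) = r k := fun γ k =>
    congrArg Quotient.out (Quotient.sound (s := MulAction.orbitRel Γ K) ⟨γ, rfl⟩)
  refine ⟨fun m k => pushAct (σ k) (ρ (r k) m), fun m k => (hρ _ m).pushAct _, fun γ k => ?_⟩
  have hmem : (σ k)⁻¹ * (γ * σ (γ⁻¹ • k)) ∈ MulAction.stabilizer Γ (r k) := by
    have h := hσ (γ⁻¹ • k)
    rw [hr_smul] at h
    rw [MulAction.mem_stabilizer_iff, mul_smul, mul_smul, h, smul_inv_smul, inv_smul_eq_iff, hσ]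
  refine (hlim (r k) _ hmem).congr fun m => ?_
  beta_reduce
  rw [hr_smul, ← pushAct_mul, l1dist_comm, ← l1dist_pushAct (σ k), ← pushAct_mul,
    mul_inv_cancel_left]

theorem summable_mul_of_isProbFn {K Γ : Type*} {a : K → ℝ} {ν : K → Γ → ℝ} (ha : Summable a)
    (ha0 : ∀ k, 0 ≤ a k) (hν : ∀ k, IsProbFn (ν k)) :
    Summable fun p : K × Γ => a p.1 * ν p.1 p.2 := by
  have h0 : 0 ≤ fun p : K × Γ => a p.1 * ν p.1 p.2 :=
    fun p => mul_nonneg (ha0 p.1) ((hν p.1).1 p.2)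
  refine (summable_prod_of_nonneg h0).2 ⟨fun k => (hν k).summable.mul_left (a k), ?_⟩
  exact ha.congr fun k => by simp only [tsum_mul_left, (hν k).2.tsum_eq, mul_one]

theorem isProbFn_mixture {K Γ : Type*} {a : K → ℝ} {ν : K → Γ → ℝ} (ha : IsProbFn a)
    (hν : ∀ k, IsProbFn (ν k)) : IsProbFn (mixture a ν) := by
  have hs := summable_mul_of_isProbFn ha.summable ha.1 hν
  refine ⟨fun g => tsum_nonneg fun k => mul_nonneg (ha.1 k) ((hν k).1 g), ?_⟩
  have hsum : Summable (mixture a ν) := hs.prod_symm.prod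
  have h1 : ∑' g, mixture a ν g = 1 := by
    refine (hs.tsum_comm (f := fun k g => a k * ν k g)).trans ?_
    simp only [tsum_mul_left, (hν _).2.tsum_eq, mul_one, ha.2.tsum_eq]
  exact h1 ▸ hsum.hasSum

theorem pushAct_mixture {Γ K : Type*} [Group Γ] [MulAction Γ K] (γ : Γ) (a : K → ℝ)
    (ν : K → Γ → ℝ) :
    pushAct γ (mixture a ν) = mixture (pushAct γ a) fun k => pushAct γ (ν (γ⁻¹ • k)) :=
  funext fun g => ((MulAction.toPerm γ⁻¹).tsum_eq fun k => a k * ν k (γ⁻¹ • g)).symm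

theorem l1dist_mixture_le {K Γ : Type*} {a b : K → ℝ} {ν ν' : K → Γ → ℝ} (ha : IsProbFn a)
    (hb : IsProbFn b) (hν : ∀ k, IsProbFn (ν k)) (hν' : ∀ k, IsProbFn (ν' k)) :
    l1dist (mixture b ν) (mixture a ν') ≤
      l1dist b a + ∑' k, a k * l1dist (ν k) (ν' k) := by
  have hbν := summable_mul_of_isProbFn hb.summable hb.1 hν
  have haν := summable_mul_of_isProbFn ha.summable ha.1 hν
  have haν' := summable_mul_of_isProbFn ha.summable ha.1 hν'
  have hF : Summable fun p : K × Γ => |b p.1 - a p.1| * ν p.1 p.2 :=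
    summable_mul_of_isProbFn (hb.summable_abs_sub ha) (fun _ => abs_nonneg _) hν
  have hG : Summable fun p : K × Γ => a p.1 * |ν p.1 p.2 - ν' p.1 p.2| :=
    (haν.sub haν').abs.congr fun p => by
      rw [← mul_sub, abs_mul, abs_of_nonneg (ha.1 _)]
  have hFG := hF.add hG
  have hswap := hFG.prod_symm
  have hle : ∀ g, |mixture b ν g - mixture a ν' g| ≤
      ∑' k, (|b k - a k| * ν k g + a k * |ν k g - ν' k g|) := fun g => by
    have h1 : Summable fun k => b k * ν k g := hbν.prod_symm.prod_factor g
    have h2 : Summable fun k => a k * ν' k g := haν'.prod_symm.prod_factor g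
    rw [mixture, mixture, ← h1.tsum_sub h2]
    refine tsum_of_norm_bounded (E := ℝ) (hswap.prod_factor g).hasSum fun k => ?_
    rw [Real.norm_eq_abs, show b k * ν k g - a k * ν' k g =
      (b k - a k) * ν k g + a k * (ν k g - ν' k g) by ring]
    refine (abs_add_le _ _).trans_eq ?_
    rw [abs_mul, abs_mul, abs_of_nonneg ((hν k).1 g), abs_of_nonneg (ha.1 k)]
    rfl
  calc l1dist (mixture b ν) (mixture a ν')
      ≤ ∑' g, ∑' k, (|b k - a k| * ν k g + a k * |ν k g - ν' k g|) :=
        ((isProbFn_mixture hb hν).summable_abs_sub (isProbFn_mixture ha hν')).tsum_le_tsum hle hswap.prod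
    _ = ∑' k, ∑' g, (|b k - a k| * ν k g + a k * |ν k g - ν' k g|) := hswap.tsum_comm.symm
    _ = ∑' k, (|b k - a k| + a k * l1dist (ν k) (ν' k)) := tsum_congr fun k => by
        refine ((hF.prod_factor k).tsum_add (hG.prod_factor k)).trans ?_
        simp only [tsum_mul_left, (hν k).2.tsum_eq, mul_one, l1dist]
    _ = l1dist b a + ∑' k, a k * l1dist (ν k) (ν' k) := by
        refine (hb.summable_abs_sub ha).tsum_add (hG.prod.congr fun k => ?_)
        simp only [tsum_mul_left, l1dist]

theorem tendsto_tsum_mul_l1dist {K Γ : Type*} {a : K → ℝ} (ha : IsProbFn a)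
    {ν ν' : ℕ → K → Γ → ℝ} (hν : ∀ m k, IsProbFn (ν m k)) (hν' : ∀ m k, IsProbFn (ν' m k))
    (h : ∀ k, Tendsto (fun m => l1dist (ν m k) (ν' m k)) atTop (𝓝 0)) :
    Tendsto (fun m => ∑' k, a k * l1dist (ν m k) (ν' m k)) atTop (𝓝 0) := by
  have := tendsto_tsum_of_dominated_convergence (𝓕 := atTop) (g := fun _ : K => (0 : ℝ))
    (f := fun m k => a k * l1dist (ν m k) (ν' m k)) (ha.summable.mul_right 2)
    (fun k => by simpa using (h k).const_mul (a k))
    (Eventually.of_forall fun m k => by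
      rw [Real.norm_of_nonneg (mul_nonneg (ha.1 k) (l1dist_nonneg _ _))]
      exact mul_le_mul_of_nonneg_left ((hν m k).l1dist_le_two (hν' m k)) (ha.1 k))
  simpa using this

/-- Diagonal extraction, simultaneously for countably many double sequences. -/
theorem exists_diagonal_tendsto_zero {ι : Type*} [Countable ι] {f : ι → ℕ → ℕ → ℝ}
    (hf : ∀ i n, Tendsto (f i n) atTop (𝓝 0)) :
    ∃ φ : ℕ → ℕ, ∀ i, Tendsto (fun n => f i n (φ n)) atTop (𝓝 0) := by
  obtain ⟨e, he⟩ := exists_injective_nat ι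
  have hex : ∀ n : ℕ, ∃ m, ∀ i ∈ e ⁻¹' Set.Iic n, |f i n m| < 1 / ((n : ℝ) + 1) := fun n => by
    have hfin : (e ⁻¹' Set.Iic n).Finite := (Set.finite_Iic n).preimage he.injOn
    refine ((Set.Finite.eventually_all hfin).2 fun i _ => ?_).exists (f := atTop)
    have hpos : |(0 : ℝ)| < 1 / ((n : ℝ) + 1) := by simpa using Nat.cast_add_one_pos n
    exact (hf i n).abs.eventually_lt_const hpos
  choose φ hφ using hex
  refine ⟨φ, fun i => squeeze_zero_norm' ?_ (tendsto_one_div_add_atTop_nhds_zero_nat (𝕜 := ℝ))⟩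
  filter_upwards [eventually_ge_atTop (e i)] with n hn
  exact (hφ n i hn).le

/-- Ozawa's criterion, pointwise version, with amenable stabilizers:
if `Γ` acts on `X` and on a countable set `K`, and there are maps `μₙ : X → Prob(K)` with
`‖μₙ(γ·x) − γ·μₙ(x)‖₁ → 0` for all `γ, x`, and every stabilizer `Stab_Γ(k)` is amenable,
then there are maps `λₙ : X → Prob(Γ)` with `‖λₙ(γ·x) − γ·λₙ(x)‖₁ → 0` for all `γ, x`. -/
theorem ozawa_pointwise_amenable_stabilizers
    {Γ X K : Type*} [Group Γ] [Countable Γ] [Countable K]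
    [MulAction Γ X] [MulAction Γ K]
    (μ : ℕ → X → K → ℝ) (hμp : ∀ n x, IsProbFn (μ n x))
    (hμ : ∀ γ : Γ, ∀ x : X,
      Tendsto (fun n => l1dist (μ n (γ • x)) (pushAct γ (μ n x))) atTop (𝓝 0))
    (hstab : ∀ k : K, ReiterAmenable ↥(MulAction.stabilizer Γ k)) :
    ∃ lam : ℕ → X → Γ → ℝ, (∀ n x, IsProbFn (lam n x)) ∧
      ∀ γ : Γ, ∀ x : X,
        Tendsto (fun n => l1dist (lam n (γ • x)) (pushAct γ (lam n x))) atTop (𝓝 0) := by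
  obtain ⟨ν, hν, hlim⟩ := exists_almost_equivariant_of_stabilizer hstab
  let err : Γ → X → ℕ → ℕ → ℝ := fun γ x n m =>
    ∑' k, pushAct γ (μ n x) k * l1dist (ν m k) (pushAct γ (ν m (γ⁻¹ • k)))
  have herr : ∀ γ x n, Tendsto (err γ x n) atTop (𝓝 0) := fun γ x n =>
    tendsto_tsum_mul_l1dist ((hμp n x).pushAct γ) hν (fun m k => (hν m _).pushAct γ) (hlim γ)
  -- The diagonal index may depend on the orbit of the point, but not on the point itself.
  have hdiag : ∀ o : MulAction.orbitRel.Quotient Γ X, ∃ φ : ℕ → ℕ, ∀ p : Γ × Γ,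
      Tendsto (fun n => err p.1 (p.2 • o.out) n (φ n)) atTop (𝓝 0) := fun o =>
    exists_diagonal_tendsto_zero fun p n => herr p.1 (p.2 • o.out) n
  choose φ hφ using hdiag
  let q : X → MulAction.orbitRel.Quotient Γ X := Quotient.mk (MulAction.orbitRel Γ X)
  have hq : ∀ (γ : Γ) x, q (γ • x) = q x := fun γ x =>
    Quotient.sound (s := MulAction.orbitRel Γ X) ⟨γ, rfl⟩
  refine ⟨fun n x => mixture (μ n x) (ν (φ (q x) n)),
    fun n x => isProbFn_mixture (hμp n x) (hν _), fun γ x => ?_⟩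
  obtain ⟨g, hg⟩ : ∃ g : Γ, g • (q x).out = x :=
    (MulAction.orbitRel Γ X).symm (Quotient.mk_out (s := MulAction.orbitRel Γ X) x)
  have hsum := (hμ γ x).add (hφ (q x) (γ, g))
  simp only [hg, add_zero] at hsum
  refine squeeze_zero (fun _ => l1dist_nonneg _ _) (fun n => ?_) hsum
  beta_reduce
  rw [hq, pushAct_mixture]
  exact l1dist_mixture_le ((hμp n x).pushAct γ) (hμp n _) (hν _) fun k => (hν _ _).pushAct γ
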